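/- Fix two distinct primitive types l and r and a natural number N. For any sequent A1,…,An → B in which every type has size at most N and contains neither l nor r: (i) e_N(B) is even-cyclic and each o_N(Ai) is odd-cyclic; (ii) A1,…,An → B is derivable in L^∘ if and only if o_N(A1),…,o_N(An) → e_N(B) is derivable in L^∘. -/

import Mathlib

/-- Types of the Lambek calculus with the cyclic shift `L^∘`, built from
primitive types `P` by `\` (`ldiv A B = A \ B`), `/` (`rdiv B A = B / A`),
`·` (`mul`) and the cyclic shift `^∘` (`circ`). -/
inductive Fm (P : Type) : Type
  | prim : P → Fm P
  | ldiv : Fm P → Fm P → Fm P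
  | rdiv : Fm P → Fm P → Fm P
  | mul  : Fm P → Fm P → Fm P
  | circ : Fm P → Fm P
deriving DecidableEq

open Fm

/-- Derivability of sequents in the Lambek calculus with the cyclic shift `L^∘`.
The Boolean flag indicates whether the rule (cut) may be used:
`Dv P true` is `L^∘` (with cut), `Dv P false` is its cut-free part. -/
inductive Dv (P : Type) : Bool → List (Fm P) → Fm P → Prop
  | ax (c : Bool) (A : Fm P) :
      Dv P c [A] A
  | ldivL (c : Bool) (Γ Δ Pi : List (Fm P)) (A B C : Fm P) :
      Dv P c (Γ ++ B :: Δ) C → Dv P c Pi A → Pi ≠ [] →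
      Dv P c (Γ ++ Pi ++ ldiv A B :: Δ) C
  | ldivR (c : Bool) (Pi : List (Fm P)) (A B : Fm P) :
      Dv P c (A :: Pi) B → Pi ≠ [] →
      Dv P c Pi (ldiv A B)
  | rdivL (c : Bool) (Γ Δ Pi : List (Fm P)) (A B C : Fm P) :
      Dv P c (Γ ++ B :: Δ) C → Dv P c Pi A → Pi ≠ [] →
      Dv P c (Γ ++ rdiv B A :: (Pi ++ Δ)) C
  | rdivR (c : Bool) (Pi : List (Fm P)) (A B : Fm P) :
      Dv P c (Pi ++ [A]) B → Pi ≠ [] →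
      Dv P c Pi (rdiv B A)
  | mulL (c : Bool) (Γ Δ : List (Fm P)) (A B C : Fm P) :
      Dv P c (Γ ++ A :: B :: Δ) C →
      Dv P c (Γ ++ mul A B :: Δ) C
  | mulR (c : Bool) (Pi Psi : List (Fm P)) (A B : Fm P) :
      Dv P c Pi A → Dv P c Psi B → Pi ≠ [] → Psi ≠ [] →
      Dv P c (Pi ++ Psi) (mul A B)
  | circR (c : Bool) (Pi : List (Fm P)) (A : Fm P) :
      Dv P c Pi A →
      Dv P c Pi (circ A)
  | circL (c : Bool) (A B : Fm P) :
      Dv P c [B] (circ A) →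
      Dv P c [circ B] (circ A)
  | circC (c : Bool) (Pi Psi : List (Fm P)) (A : Fm P) :
      Dv P c (Pi ++ Psi) (circ A) → Pi ≠ [] → Psi ≠ [] →
      Dv P c (Psi ++ Pi) (circ A)
  | cut (Γ Δ Pi : List (Fm P)) (A B : Fm P) :
      Dv P true Pi A → Dv P true (Γ ++ A :: Δ) B → Pi ≠ [] →
      Dv P true (Γ ++ Pi ++ Δ) B

/-- The size of a type: the total number of connectives in it. -/
def fsize {P : Type} : Fm P → ℕ
  | Fm.prim _ => 0
  | Fm.ldiv A B => fsize A + fsize B + 1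
  | Fm.rdiv A B => fsize A + fsize B + 1
  | Fm.mul A B => fsize A + fsize B + 1
  | Fm.circ A => fsize A + 1

/-- The type contains neither of the primitive types `l`, `r`. -/
def avoids {P : Type} (l r : P) : Fm P → Prop
  | Fm.prim p => p ≠ l ∧ p ≠ r
  | Fm.ldiv A B => avoids l r A ∧ avoids l r B
  | Fm.rdiv A B => avoids l r A ∧ avoids l r B
  | Fm.mul A B => avoids l r A ∧ avoids l r B
  | Fm.circ A => avoids l r A

/-- `cyclicOK true A` says that `A` is even-cyclic (no odd subtype occurrence
of the form `B^∘`); `cyclicOK false A` says that `A` is odd-cyclic (no even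
subtype occurrence of the form `B^∘`).  Recall `ldiv A B = A \ B` and
`rdiv B A = B / A`, so the first argument of `ldiv` and the second argument of
`rdiv` are the denominators, where parity flips. -/
def cyclicOK {P : Type} : Bool → Fm P → Prop
  | _, Fm.prim _ => True
  | b, Fm.ldiv A B => cyclicOK (!b) A ∧ cyclicOK b B
  | b, Fm.rdiv B A => cyclicOK b B ∧ cyclicOK (!b) A
  | b, Fm.mul A B => cyclicOK b A ∧ cyclicOK b B
  | b, Fm.circ A => b = true ∧ cyclicOK b A

/-- `A^□ := (l \ ((l·A)·r)) / r`. -/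
def fbox {P : Type} (l r : P) (A : Fm P) : Fm P :=
  Fm.rdiv (Fm.ldiv (Fm.prim l) (Fm.mul (Fm.mul (Fm.prim l) A) (Fm.prim r))) (Fm.prim r)

/-- `trN l r N true` is the function `e_N` and `trN l r N false` is `o_N`:
each even (resp. odd) subtype occurrence of the form `B^∘` is replaced by
`B^{(□∘)^N}`, and each odd (resp. even) such occurrence by `B^□`. -/
def trN {P : Type} (l r : P) (N : ℕ) : Bool → Fm P → Fm P
  | _, Fm.prim p => Fm.prim p
  | b, Fm.ldiv A B => Fm.ldiv (trN l r N (!b) A) (trN l r N b B)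
  | b, Fm.rdiv B A => Fm.rdiv (trN l r N b B) (trN l r N (!b) A)
  | b, Fm.mul A B => Fm.mul (trN l r N b A) (trN l r N b B)
  | true, Fm.circ A => (fun X => Fm.circ (fbox l r X))^[N] (trN l r N true A)
  | false, Fm.circ A => fbox l r (trN l r N false A)


theorem Dv.ne {P : Type} {c : Bool} {Γ : List (Fm P)} {B : Fm P} (h : Dv P c Γ B) : Γ ≠ [] := by
  induction h <;> simp_all

namespace Okada
variable {P : Type} (l r : P)

/-- Cut-free provability sets restricted to words avoiding `l`, `r`. -/
def T (B : Fm P) : Set (List (Fm P)) := {w | Dv P false w B ∧ ∀ A ∈ w, avoids l r A}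

def TP (B : Fm P) : Set (List (Fm P)) :=
  {w | ∃ g, w = prim l :: (g ++ [prim r]) ∧ g ∈ T l r (circ B)}

def IsB (S : Set (List (Fm P))) : Prop := (∃ B, S = T l r B) ∨ ∃ B, S = TP l r B

def cl (X : Set (List (Fm P))) : Set (List (Fm P)) :=
  {w | w ≠ [] ∧ ∀ S u v, IsB l r S → (∀ x ∈ X, u ++ x ++ v ∈ S) → u ++ w ++ v ∈ S}

def Closed (X : Set (List (Fm P))) : Prop := cl l r X ⊆ X

def limp (X Y : Set (List (Fm P))) : Set (List (Fm P)) := {w | w ≠ [] ∧ ∀ x ∈ X, x ++ w ∈ Y}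
def rimp (Y X : Set (List (Fm P))) : Set (List (Fm P)) := {w | w ≠ [] ∧ ∀ x ∈ X, w ++ x ∈ Y}
def cat (X Y : Set (List (Fm P))) : Set (List (Fm P)) := {w | ∃ x ∈ X, ∃ y ∈ Y, w = x ++ y}
def cyc (X : Set (List (Fm P))) : Set (List (Fm P)) :=
  {w | w ≠ [] ∧ ∀ C, X ⊆ T l r (circ C) → w ∈ T l r (circ C)}

open Classical in
noncomputable def val : Fm P → Set (List (Fm P))
  | Fm.prim p => if p = l then cl l r {[prim l]} else if p = r then cl l r {[prim r]}
      else T l r (prim p)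
  | Fm.ldiv A B => limp (val A) (val B)
  | Fm.rdiv B A => rimp (val B) (val A)
  | Fm.mul A B => cl l r (cat (val A) (val B))
  | Fm.circ A => cyc l r (val A)

variable {l r}

theorem T_ne {B : Fm P} {w} (h : w ∈ T l r B) : w ≠ [] := h.1.ne

theorem cl_sub {X Y : Set (List (Fm P))} (hY : Closed l r Y) (h : X ⊆ Y) : cl l r X ⊆ Y := by
  intro w hw
  exact hY ⟨hw.1, fun S u v hS hx => hw.2 S u v hS fun x hxX => hx x (h hxX)⟩

theorem sub_cl {X : Set (List (Fm P))} (h : ∀ x ∈ X, x ≠ []) : X ⊆ cl l r X :=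
  fun w hw => ⟨h w hw, fun _ _ _ _ hx => hx w hw⟩

theorem closed_cl (X : Set (List (Fm P))) : Closed l r (cl l r X) := by
  intro w hw
  exact ⟨hw.1, fun S u v hS hx => hw.2 S u v hS fun x hxX => hxX.2 S u v hS hx⟩

theorem closed_base {S : Set (List (Fm P))} (hS : IsB l r S) : Closed l r S := by
  intro w hw
  simpa using hw.2 S [] [] hS (by simp)

theorem closed_T (B : Fm P) : Closed l r (T l r B) := closed_base (Or.inl ⟨B, rfl⟩)
theorem closed_TP (B : Fm P) : Closed l r (TP l r B) := closed_base (Or.inr ⟨B, rfl⟩)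

theorem cl_ctx {X Y : Set (List (Fm P))} (hY : Closed l r Y) {g x d : List (Fm P)}
    (hx : x ∈ cl l r X) (h : ∀ y ∈ X, g ++ y ++ d ∈ Y) : g ++ x ++ d ∈ Y := by
  apply hY
  refine ⟨by simp [hx.1], fun S u v hS hy => ?_⟩
  have := hx.2 S (u ++ g) (d ++ v) hS (fun y hyX => by simpa using hy _ (h y hyX))
  simpa using this

theorem closed_limp {X Y : Set (List (Fm P))} (hY : Closed l r Y) : Closed l r (limp X Y) := by
  intro w hw
  refine ⟨hw.1, fun x hx => ?_⟩
  have := cl_ctx (g := x) (d := []) hY hw (fun y hy => by simpa using hy.2 x hx)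
  simpa using this

theorem closed_rimp {X Y : Set (List (Fm P))} (hY : Closed l r Y) : Closed l r (rimp Y X) := by
  intro w hw
  refine ⟨hw.1, fun x hx => ?_⟩
  have := cl_ctx (g := []) (d := x) hY hw (fun y hy => by simpa using hy.2 x hx)
  simpa using this

theorem closed_cyc {X : Set (List (Fm P))} : Closed l r (cyc l r X) := by
  intro w hw
  refine ⟨hw.1, fun C hC => ?_⟩
  exact cl_sub (closed_T _) (fun y hy => hy.2 C hC) hw

theorem val_closed (A : Fm P) : Closed l r (val l r A) := by
  induction A with
  | prim p =>
    unfold val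
    split_ifs
    · exact closed_cl _
    · exact closed_cl _
    · exact closed_T _
  | ldiv A B _ hB => exact closed_limp hB
  | rdiv B A hB _ => exact closed_rimp hB
  | mul A B _ _ => exact closed_cl _
  | circ A _ => exact closed_cyc

theorem val_ne (A : Fm P) : ∀ w ∈ val l r A, w ≠ [] := by
  intro w hw
  cases A with
  | prim p =>
    unfold val at hw
    split_ifs at hw
    · exact hw.1
    · exact hw.1
    · exact T_ne hw
  | ldiv A B => exact hw.1
  | rdiv B A => exact hw.1
  | mul A B => exact hw.1
  | circ A => exact hw.1

variable (l r) in
noncomputable def pr : List (Fm P) → Set (List (Fm P))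
  | [] => {[]}
  | A :: Γ => cat (val l r A) (pr Γ)

theorem pr_append (Γ Δ : List (Fm P)) : pr l r (Γ ++ Δ) = cat (pr l r Γ) (pr l r Δ) := by
  induction Γ with
  | nil => ext w; simp [pr, cat]
  | cons A Γ ih =>
    ext w
    simp only [List.cons_append, pr, ih, cat, Set.mem_setOf_eq]
    constructor
    · rintro ⟨x, hx, _, ⟨y, hy, z, hz, rfl⟩, rfl⟩
      exact ⟨x ++ y, ⟨x, hx, y, hy, rfl⟩, z, hz, by simp⟩
    · rintro ⟨_, ⟨x, hx, y, hy, rfl⟩, z, hz, rfl⟩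
      exact ⟨x, hx, y ++ z, ⟨y, hy, z, hz, rfl⟩, by simp⟩

theorem pr_ne {Γ : List (Fm P)} (h : Γ ≠ []) : ∀ w ∈ pr l r Γ, w ≠ [] := by
  cases Γ with
  | nil => simp at h
  | cons A Γ =>
    rintro _ ⟨x, hx, y, hy, rfl⟩
    simp [val_ne A x hx]

theorem mem_pr_append {Γ Δ : List (Fm P)} {x y} (hx : x ∈ pr l r Γ) (hy : y ∈ pr l r Δ) :
    x ++ y ∈ pr l r (Γ ++ Δ) := by
  rw [pr_append]; exact ⟨x, hx, y, hy, rfl⟩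

theorem mem_pr_cons {A : Fm P} {Δ : List (Fm P)} {x y} (hx : x ∈ val l r A) (hy : y ∈ pr l r Δ) :
    x ++ y ∈ pr l r (A :: Δ) := ⟨x, hx, y, hy, rfl⟩

theorem mem_pr_single {A : Fm P} {x} (hx : x ∈ val l r A) : x ∈ pr l r [A] :=
  ⟨x, hx, [], rfl, by simp⟩

theorem sound {c : Bool} {Γ : List (Fm P)} {B : Fm P} (h : Dv P c Γ B) :
    pr l r Γ ⊆ val l r B := by
  induction h with
  | ax c A =>
    rintro _ ⟨x, hx, y, rfl, rfl⟩
    simpa using hx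
  | ldivL c Γ Δ Pi A B C _ _ _ ih1 ih2 =>
    rw [pr_append, pr_append]
    rintro _ ⟨_, ⟨g, hg, p, hp, rfl⟩, _, ⟨x, hx, d, hd, rfl⟩, rfl⟩
    have := ih1 (mem_pr_append hg (mem_pr_cons (hx.2 p (ih2 hp)) hd))
    simpa using this
  | ldivR c Pi A B _ hne ih =>
    intro w hw
    exact ⟨pr_ne hne w hw, fun x hx => ih (mem_pr_cons hx hw)⟩
  | rdivL c Γ Δ Pi A B C _ _ _ ih1 ih2 =>
    rw [pr_append]
    rintro _ ⟨g, hg, _, ⟨x, hx, _, hpd, rfl⟩, rfl⟩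
    rw [pr_append] at hpd
    obtain ⟨p, hp, d, hd, rfl⟩ := hpd
    have := ih1 (mem_pr_append hg (mem_pr_cons (hx.2 p (ih2 hp)) hd))
    simpa using this
  | rdivR c Pi A B _ hne ih =>
    intro w hw
    exact ⟨pr_ne hne w hw, fun x hx => ih (mem_pr_append hw (mem_pr_single hx))⟩
  | mulL c Γ Δ A B C _ ih =>
    rw [pr_append]
    rintro _ ⟨g, hg, _, ⟨x, hx, d, hd, rfl⟩, rfl⟩
    have := cl_ctx (g := g) (d := d) (val_closed C) hx (by
      rintro _ ⟨a, ha, b, hb, rfl⟩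
      have := ih (mem_pr_append hg (mem_pr_cons ha (mem_pr_cons hb hd)))
      simpa using this)
    simpa using this
  | mulR c Pi Psi A B _ _ h1 _ ih1 ih2 =>
    rw [pr_append]
    rintro _ ⟨p, hp, q, hq, rfl⟩
    apply sub_cl
    · rintro _ ⟨a, ha, b, hb, rfl⟩
      simp [val_ne A a ha]
    · exact ⟨p, ih1 hp, q, ih2 hq, rfl⟩
  | circR c Pi A _ ih =>
    intro w hw
    exact ⟨val_ne A w (ih hw), fun C hC => hC (ih hw)⟩
  | circL c A B _ ih =>
    rintro _ ⟨x, hx, y, rfl, rfl⟩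
    rw [List.append_nil]
    refine ⟨hx.1, fun C hC => hx.2 C fun y hy => ?_⟩
    exact (ih (mem_pr_single hy)).2 C hC
  | circC c Pi Psi A _ h1 h2 ih =>
    rw [pr_append]
    rintro _ ⟨p, hp, q, hq, rfl⟩
    have h := ih (mem_pr_append hq hp)
    have hp' := pr_ne h2 p hp
    have hq' := pr_ne h1 q hq
    refine ⟨by simp [hp'], fun C hC => ?_⟩
    obtain ⟨k1, k2⟩ := h.2 C hC
    exact ⟨Dv.circC _ _ _ _ k1 hq' hp', fun A hA => k2 A (by simp at hA ⊢; tauto)⟩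
  | cut Γ Δ Pi A B _ _ _ ih1 ih2 =>
    rw [pr_append, pr_append]
    rintro _ ⟨_, ⟨g, hg, p, hp, rfl⟩, d, hd, rfl⟩
    have := ih2 (mem_pr_append hg (mem_pr_cons (ih1 hp) hd))
    simpa using this

theorem transfer {S : Set (List (Fm P))} (hS : IsB l r S) {u v ys zs : List (Fm P)}
    (hy0 : ys ≠ []) (hy : ∀ A ∈ ys, avoids l r A) (hz : ∀ A ∈ zs, avoids l r A)
    (hd : ∀ u v C, Dv P false (u ++ ys ++ v) C → Dv P false (u ++ zs ++ v) C)
    (h : u ++ ys ++ v ∈ S) : u ++ zs ++ v ∈ S := by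
  have key : ∀ (u v : List (Fm P)) C, u ++ ys ++ v ∈ T l r C → u ++ zs ++ v ∈ T l r C := by
    rintro u v C ⟨h1, h2⟩
    refine ⟨hd _ _ _ h1, fun A hA => ?_⟩
    simp only [List.mem_append] at hA h2
    rcases hA with (hA | hA) | hA
    · exact h2 A (by tauto)
    · exact hz A hA
    · exact h2 A (by tauto)
  rcases hS with ⟨B, rfl⟩ | ⟨B, rfl⟩
  · exact key _ _ _ h
  · obtain ⟨g, hg, hgT⟩ := h
    have hl : ¬ avoids l r (prim l) := by simp [avoids]
    have hr : ¬ avoids l r (prim r) := by simp [avoids]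
    cases u with
    | nil =>
      cases ys with
      | nil => simp at hy0
      | cons y ys =>
        simp at hg
        exact absurd (hg.1 ▸ hy y (by simp)) hl
    | cons a u =>
      simp only [List.cons_append, List.cons.injEq] at hg
      obtain ⟨rfl, hg⟩ := hg
      rcases List.eq_nil_or_concat' v with rfl | ⟨v, b, rfl⟩
      · rcases List.eq_nil_or_concat' ys with rfl | ⟨ys', b, rfl⟩
        · simp at hy0
        · rw [List.append_nil, ← List.append_assoc] at hg
          have := (List.append_inj' hg rfl).2
          simp at this
          exact absurd (this ▸ hy b (by simp)) hr
      · rw [← List.append_assoc] at hg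
        obtain ⟨h1, h2⟩ := List.append_inj' hg rfl
        simp at h2
        subst h2 h1
        exact ⟨u ++ zs ++ v, by simp, key _ _ _ hgT⟩

theorem mem_of_transfer {Y : Set (List (Fm P))} (hY : Closed l r Y) {ys zs : List (Fm P)}
    (hy0 : ys ≠ []) (hz0 : zs ≠ [])
    (hy : ∀ A ∈ ys, avoids l r A) (hz : ∀ A ∈ zs, avoids l r A)
    (hd : ∀ u v C, Dv P false (u ++ ys ++ v) C → Dv P false (u ++ zs ++ v) C)
    (h : ys ∈ Y) : zs ∈ Y :=
  hY ⟨hz0, fun _ _ _ hS hx => transfer hS hy0 hy hz hd (hx ys h)⟩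

section conn
variable {A B : Fm P} {X Y : Set (List (Fm P))}

theorem ldiv_o (hA : avoids l r A) (hB : avoids l r B) (hX : X ⊆ T l r A) (hY : Closed l r Y)
    (hb : [B] ∈ Y) : [ldiv A B] ∈ limp X Y := by
  refine ⟨by simp, fun p hp => ?_⟩
  have hp := hX hp
  refine mem_of_transfer hY (ys := [B]) (by simp) (by simp) (by simpa using hB) ?_ ?_ hb
  · intro D hD
    simp only [List.mem_append, List.mem_singleton] at hD
    rcases hD with hD | rfl
    · exact hp.2 D hD
    · exact ⟨hA, hB⟩
  · intro u v C h
    have := Dv.ldivL false u v p A B C (by simpa using h) hp.1 (T_ne hp)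
    simpa using this

theorem rdiv_o (hA : avoids l r A) (hB : avoids l r B) (hX : X ⊆ T l r A) (hY : Closed l r Y)
    (hb : [B] ∈ Y) : [rdiv B A] ∈ rimp Y X := by
  refine ⟨by simp, fun p hp => ?_⟩
  have hp := hX hp
  refine mem_of_transfer hY (ys := [B]) (by simp) (by simp) (by simpa using hB) ?_ ?_ hb
  · intro D hD
    simp only [List.mem_append, List.mem_singleton] at hD
    rcases hD with rfl | hD
    · exact ⟨hB, hA⟩
    · exact hp.2 D hD
  · intro u v C h
    have := Dv.rdivL false u v p A B C (by simpa using h) hp.1 (T_ne hp)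
    simpa using this

theorem ldiv_e (ha : [A] ∈ X) (hY : Y ⊆ T l r B) : limp X Y ⊆ T l r (ldiv A B) := by
  rintro w ⟨h0, hw⟩
  obtain ⟨h1, h2⟩ := hY (hw _ ha)
  exact ⟨Dv.ldivR _ _ _ _ h1 h0, fun D hD => h2 D (by simp [hD])⟩

theorem rdiv_e (ha : [A] ∈ X) (hY : Y ⊆ T l r B) : rimp Y X ⊆ T l r (rdiv B A) := by
  rintro w ⟨h0, hw⟩
  obtain ⟨h1, h2⟩ := hY (hw _ ha)
  exact ⟨Dv.rdivR _ _ _ _ h1 h0, fun D hD => h2 D (by simp [hD])⟩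

theorem mul_o (hA : avoids l r A) (hB : avoids l r B) (ha : [A] ∈ X) (hb : [B] ∈ Y) :
    [mul A B] ∈ cl l r (cat X Y) := by
  have h0 : [A, B] ∈ cl l r (cat X Y) :=
    ⟨by simp, fun S u v hS hx => hx _ ⟨_, ha, _, hb, rfl⟩⟩
  refine mem_of_transfer (closed_cl _) (by simp) (by simp) ?_ ?_ ?_ h0
  · simp [hA, hB]
  · simp [avoids, hA, hB]
  · intro u v C h
    have := Dv.mulL false u v A B C (by simpa using h)
    simpa using this

theorem mul_e (hX : X ⊆ T l r A) (hY : Y ⊆ T l r B) : cl l r (cat X Y) ⊆ T l r (mul A B) := by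
  apply cl_sub (closed_T _)
  rintro _ ⟨x, hx, y, hy, rfl⟩
  have hx := hX hx
  have hy := hY hy
  refine ⟨Dv.mulR _ _ _ _ _ hx.1 hy.1 (T_ne hx) (T_ne hy), fun D hD => ?_⟩
  rcases List.mem_append.1 hD with h | h
  · exact hx.2 D h
  · exact hy.2 D h

theorem T_circ : T l r A ⊆ T l r (circ A) := fun _ hw => ⟨Dv.circR _ _ _ hw.1, hw.2⟩

theorem circ_o (hA : avoids l r A) (ha : [A] ∈ X) : [circ A] ∈ cyc l r X := by
  refine ⟨by simp, fun C hC => ⟨Dv.circL _ _ _ (hC ha).1, by simpa [avoids] using hA⟩⟩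

theorem circ_e (hX : X ⊆ T l r (circ A)) : cyc l r X ⊆ T l r (circ A) :=
  fun _ hw => hw.2 A hX

end conn

theorem val_prim {p : P} (h : avoids l r (prim p)) : val l r (prim p) = T l r (prim p) := by
  obtain ⟨h1, h2⟩ := h
  simp [val, h1, h2]

theorem ax_T {A : Fm P} (h : avoids l r A) : [A] ∈ T l r A :=
  ⟨Dv.ax _ _, by simpa using h⟩

theorem okada_id (A : Fm P) (h : avoids l r A) : [A] ∈ val l r A ∧ val l r A ⊆ T l r A := by
  induction A with
  | prim p => rw [val_prim h]; exact ⟨ax_T h, subset_rfl⟩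
  | ldiv A B iA iB =>
    have a := iA h.1
    have b := iB h.2
    exact ⟨ldiv_o h.1 h.2 a.2 (val_closed B) b.1, ldiv_e a.1 b.2⟩
  | rdiv B A iB iA =>
    have a := iA h.2
    have b := iB h.1
    exact ⟨rdiv_o h.2 h.1 a.2 (val_closed B) b.1, rdiv_e a.1 b.2⟩
  | mul A B iA iB =>
    have a := iA h.1
    have b := iB h.2
    exact ⟨mul_o h.1 h.2 a.1 b.1, mul_e a.2 b.2⟩
  | circ A iA =>
    have a := iA h
    exact ⟨circ_o h a.1, circ_e (a.2.trans T_circ)⟩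

theorem l_mem : [prim l] ∈ val l r (prim l) := by
  simp only [val, if_true]
  exact sub_cl (by simp) rfl

theorem r_mem : [prim r] ∈ val l r (prim r) := by
  simp only [val, if_true]
  split_ifs with h
  · subst h; exact sub_cl (by simp) rfl
  · exact sub_cl (by simp) rfl

theorem val_l : val l r (prim l) = cl l r {[prim l]} := by simp [val]
theorem val_r : val l r (prim r) = cl l r {[prim r]} := by
  simp only [val, if_true]
  split_ifs with h
  · subst h; rfl
  · rfl

theorem box_o (hlr : l ≠ r) {A X : Fm P} (hA : avoids l r A) (ha : [A] ∈ val l r X) :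
    [circ A] ∈ val l r (fbox l r X) := by
  refine ⟨by simp, fun y hy => ⟨by simp, fun x hx => ?_⟩⟩
  set Z := val l r (mul (mul (prim l) X) (prim r)) with hZ
  have hZc : Closed l r Z := val_closed _
  rw [val_l] at hx
  rw [val_r] at hy
  -- reduce to the generators
  suffices h : [prim l] ++ [circ A] ++ [prim r] ∈ Z by
    have h1 : x ++ [circ A] ++ [prim r] ∈ Z := by
      have := cl_ctx (g := []) (d := [circ A] ++ [prim r]) hZc hx
        (by rintro _ rfl; simpa using h)
      simpa using this
    have := cl_ctx (g := x ++ [circ A]) (d := []) hZc hy (by rintro _ rfl; simpa using h1)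
    simpa using this
  have h0 : [prim l] ++ [A] ++ [prim r] ∈ Z := by
    apply sub_cl
    · rintro _ ⟨a, ha, b, hb, rfl⟩
      simp [val_ne _ a ha]
    · refine ⟨[prim l] ++ [A], ?_, [prim r], r_mem, rfl⟩
      apply sub_cl
      · rintro _ ⟨a, ha, b, hb, rfl⟩
        simp [val_ne _ a ha]
      · exact ⟨_, l_mem, _, ha, rfl⟩
  apply hZc
  refine ⟨by simp, fun S u v hS hx => ?_⟩
  have h := hx _ h0
  rcases hS with ⟨B, rfl⟩ | ⟨B, rfl⟩
  · have := h.2 (prim l) (by simp)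
    simp [avoids] at this
  · obtain ⟨g, hg, hgT⟩ := h
    have hlg : prim l ∉ g := fun h => by simpa [avoids] using hgT.2 _ h
    have hrg : prim r ∉ g := fun h => by simpa [avoids] using hgT.2 _ h
    cases u with
    | cons a u =>
      simp only [List.cons_append, List.cons.injEq] at hg
      have : prim l ∈ g ++ [prim r] := by rw [← hg.2]; simp
      simp [hlg, hlr] at this
    | nil =>
      rcases List.eq_nil_or_concat' v with rfl | ⟨v, b, rfl⟩
      · simp only [List.nil_append, List.append_nil, List.cons_append, List.cons.injEq,
          true_and] at hg
        have := (List.append_inj' (s₁ := [A]) (t₁ := [prim r]) hg rfl).1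
        subst this
        refine ⟨[circ A], by simp, Dv.circL _ _ _ hgT.1, by simpa [avoids] using hA⟩
      · simp only [List.nil_append, List.cons_append, List.cons.injEq, true_and] at hg
        have := (List.append_inj' (s₁ := A :: prim r :: v) (t₁ := [b]) hg rfl).1
        rw [← this] at hrg
        simp at hrg

theorem box_e {A X : Fm P} (hX : val l r X ⊆ T l r (circ A)) :
    val l r (fbox l r X) ⊆ T l r (circ A) := by
  rintro w ⟨h0, hw⟩
  have h := (hw _ r_mem).2 _ l_mem
  have hs : val l r (mul (mul (prim l) X) (prim r)) ⊆ TP l r A := by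
    apply cl_sub (closed_TP _)
    rintro _ ⟨x, hx, y, hy, rfl⟩
    rw [val_r] at hy
    have := cl_ctx (g := x) (d := []) (closed_TP A) hy (by
      rintro _ rfl
      have := cl_ctx (g := []) (d := [prim r]) (closed_TP A) hx (by
        rintro _ ⟨a, ha, b, hb, rfl⟩
        rw [val_l] at ha
        have := cl_ctx (g := []) (d := b ++ [prim r]) (closed_TP A) ha (by
          rintro _ rfl
          exact ⟨b, by simp, hX hb⟩)
        simpa using this)
      simpa using this)
    simpa using this
  obtain ⟨g, hg, hgT⟩ := hs h
  simp at hg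
  exact hg ▸ hgT

theorem okada_tr (hlr : l ≠ r) (N : ℕ) (A : Fm P) (h : avoids l r A) :
    [A] ∈ val l r (trN l r N false A) ∧ val l r (trN l r N true A) ⊆ T l r A := by
  induction A with
  | prim p => simp only [trN]; rw [val_prim h]; exact ⟨ax_T h, subset_rfl⟩
  | ldiv A B iA iB =>
    have a := iA h.1
    have b := iB h.2
    exact ⟨ldiv_o h.1 h.2 a.2 (val_closed _) b.1, ldiv_e a.1 b.2⟩
  | rdiv B A iB iA =>
    have a := iA h.2
    have b := iB h.1
    exact ⟨rdiv_o h.2 h.1 a.2 (val_closed _) b.1, rdiv_e a.1 b.2⟩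
  | mul A B iA iB =>
    have a := iA h.1
    have b := iB h.2
    exact ⟨mul_o h.1 h.2 a.1 b.1, mul_e a.2 b.2⟩
  | circ A iA =>
    have a := iA h
    refine ⟨box_o hlr h a.1, ?_⟩
    simp only [trN]
    have h0 := a.2.trans T_circ
    generalize trN l r N true A = X at h0
    generalize N = k
    induction k with
    | zero => exact h0
    | succ k ih =>
      rw [Function.iterate_succ_apply']
      exact circ_e (box_e ih)

theorem mem_pr_map {f : Fm P → Fm P} (Γ : List (Fm P)) (h : ∀ A ∈ Γ, [A] ∈ val l r (f A)) :
    Γ ∈ pr l r (Γ.map f) := by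
  induction Γ with
  | nil => rfl
  | cons A Γ ih =>
    exact ⟨[A], h A (by simp), Γ, ih (fun B hB => h B (by simp [hB])), rfl⟩

theorem cut_elim {Γ : List (Fm P)} {B : Fm P} (hΓ : ∀ A ∈ Γ, avoids l r A) (hB : avoids l r B)
    (h : Dv P true Γ B) : Dv P false Γ B := by
  have h1 := mem_pr_map (f := id) Γ (fun A hA => (okada_id A (hΓ A hA)).1)
  rw [List.map_id] at h1
  exact ((okada_id B hB).2 (sound h h1)).1

theorem back (hlr : l ≠ r) (N : ℕ) {Γ : List (Fm P)} {B : Fm P} (hΓ : ∀ A ∈ Γ, avoids l r A)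
    (hB : avoids l r B) (h : Dv P true (Γ.map (trN l r N false)) (trN l r N true B)) :
    Dv P false Γ B :=
  ((okada_tr hlr N B hB).2
    (sound h (mem_pr_map Γ (fun A hA => (okada_tr hlr N A (hΓ A hA)).1)))).1

end Okada

theorem Dv.mono {P : Type} {c : Bool} {Γ : List (Fm P)} {B : Fm P} (h : Dv P c Γ B) :
    Dv P true Γ B := by
  induction h with
  | ax c A => exact Dv.ax _ A
  | ldivL c Γ Δ Pi A B C _ _ h ih1 ih2 => exact Dv.ldivL _ _ _ _ _ _ _ ih1 ih2 h
  | ldivR c Pi A B _ h ih => exact Dv.ldivR _ _ _ _ ih h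
  | rdivL c Γ Δ Pi A B C _ _ h ih1 ih2 => exact Dv.rdivL _ _ _ _ _ _ _ ih1 ih2 h
  | rdivR c Pi A B _ h ih => exact Dv.rdivR _ _ _ _ ih h
  | mulL c Γ Δ A B C _ ih => exact Dv.mulL _ _ _ _ _ _ ih
  | mulR c Pi Psi A B _ _ h1 h2 ih1 ih2 => exact Dv.mulR _ _ _ _ _ ih1 ih2 h1 h2
  | circR c Pi A _ ih => exact Dv.circR _ _ _ ih
  | circL c A B _ ih => exact Dv.circL _ _ _ ih
  | circC c Pi Psi A _ h1 h2 ih => exact Dv.circC _ _ _ _ ih h1 h2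
  | cut Γ Δ Pi A B _ _ h ih1 ih2 => exact Dv.cut _ _ _ _ _ ih1 ih2 h

namespace Fwd
variable {P : Type} {l r : P}

theorem box_R {Γ : List (Fm P)} {X : Fm P} (h : Dv P true Γ X) :
    Dv P true Γ (fbox l r X) := by
  apply Dv.rdivR _ _ _ _ _ h.ne
  apply Dv.ldivR _ _ _ _ _ (by simp)
  exact Dv.mulR true (prim l :: Γ) [prim r] _ _
    (Dv.mulR true [prim l] Γ _ _ (Dv.ax _ _) h (by simp) h.ne) (Dv.ax _ _) (by simp) (by simp)

theorem box_mono {X Y : Fm P} (h : Dv P true [X] Y) :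
    Dv P true [fbox l r X] (fbox l r Y) := by
  apply Dv.rdivR _ _ _ _ _ (by simp)
  apply Dv.ldivR _ _ _ _ _ (by simp)
  have h1 : Dv P true [prim l, X, prim r] (mul (mul (prim l) Y) (prim r)) :=
    Dv.mulR true [prim l, X] [prim r] _ _
      (Dv.mulR true [prim l] [X] _ _ (Dv.ax _ _) h (by simp) (by simp)) (Dv.ax _ _)
      (by simp) (by simp)
  have h2 := Dv.mulL true [] [] (mul (prim l) X) (prim r) _
    (Dv.mulL true [] [prim r] (prim l) X _ h1)
  have h3 := Dv.ldivL true [] [] [prim l] (prim l) _ _ h2 (Dv.ax _ _) (by simp)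
  exact Dv.rdivL true [prim l] [] [prim r] (prim r) _ _ h3 (Dv.ax _ _) (by simp)

variable (l r) in
def it (k : ℕ) (X : Fm P) : Fm P := (fun X => Fm.circ (fbox l r X))^[k] X

theorem it_succ (k : ℕ) (X : Fm P) : it l r (k + 1) X = circ (fbox l r (it l r k X)) :=
  Function.iterate_succ_apply' _ _ _

theorem it_R {Γ : List (Fm P)} {X : Fm P} (h : Dv P true Γ X) (k : ℕ) :
    Dv P true Γ (it l r k X) := by
  induction k with
  | zero => exact h
  | succ k ih => rw [it_succ]; exact Dv.circR _ _ _ (box_R ih)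

theorem ident (N : ℕ) (A : Fm P) (h : fsize A ≤ N) :
    Dv P true [trN l r N false A] (trN l r N true A) := by
  induction A with
  | prim p => exact Dv.ax _ _
  | ldiv A B iA iB =>
    simp only [fsize] at h
    have a := iA (by omega)
    have b := iB (by omega)
    exact Dv.ldivR _ _ _ _ (Dv.ldivL true [] [] [_] _ _ _ b a (by simp)) (by simp)
  | rdiv B A iB iA =>
    simp only [fsize] at h
    have a := iA (by omega)
    have b := iB (by omega)
    exact Dv.rdivR _ _ _ _ (Dv.rdivL true [] [] [_] _ _ _ b a (by simp)) (by simp)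
  | mul A B iA iB =>
    simp only [fsize] at h
    have a := iA (by omega)
    have b := iB (by omega)
    exact Dv.mulL true [] [] _ _ _ (Dv.mulR true [_] [_] _ _ a b (by simp) (by simp))
  | circ A iA =>
    simp only [fsize] at h
    have a := iA (by omega)
    obtain ⟨k, rfl⟩ : ∃ k, N = k + 1 := ⟨N - 1, by omega⟩
    change Dv P true [fbox l r _] (it l r (k + 1) _)
    rw [it_succ]
    exact Dv.circR _ _ _ (box_mono (it_R a k))

variable (l r) in
def tgt (N k : ℕ) : Fm P → Fm P
  | Fm.circ A => it l r k (trN l r N true A)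
  | B => trN l r N true B

theorem tgt_N (N : ℕ) (B : Fm P) : tgt l r N N B = trN l r N true B := by
  cases B <;> rfl

def Cond (k : ℕ) (Γ : List (Fm P)) (B : Fm P) : Prop :=
  ∀ A, B = circ A → (∀ D ∈ Γ, fsize D ≤ k) ∧ (1 ≤ k ∨ Γ.length = 1)

theorem cond_N {N : ℕ} {Γ : List (Fm P)} {B : Fm P} (h : ∀ D ∈ Γ, fsize D ≤ N)
    (hB : fsize B ≤ N) : Cond N Γ B := by
  rintro A rfl
  simp only [fsize] at hB
  exact ⟨h, Or.inl (by omega)⟩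

theorem fwd (N : ℕ) {c : Bool} {Γ : List (Fm P)} {B : Fm P} (h : Dv P c Γ B) (hc : c = false)
    (hΓ : ∀ D ∈ Γ, fsize D ≤ N) (hB : fsize B ≤ N) (k : ℕ) (hk : Cond k Γ B) :
    Dv P true (Γ.map (trN l r N false)) (tgt l r N k B) := by
  induction h generalizing k with
  | ax c A =>
    cases A with
    | circ A =>
      have := (hk A rfl).1
      simp only [List.mem_singleton, forall_eq, fsize] at this
      obtain ⟨k, rfl⟩ : ∃ j, k = j + 1 := ⟨k - 1, by omega⟩
      simp only [fsize] at hB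
      change Dv P true [fbox l r _] (it l r (k + 1) _)
      rw [it_succ]
      exact Dv.circR _ _ _ (box_mono (it_R (ident N A (by omega)) k))
    | _ => exact ident N _ hB
  | ldivL c Γ Δ Pi A B C h1 h2 hne ih1 ih2 =>
    have hs := hΓ (ldiv A B) (by simp)
    simp only [fsize] at hs
    have hPi : ∀ D ∈ Pi, fsize D ≤ N := fun D hD => hΓ D (by simp [hD])
    have a := ih2 hc hPi (by omega) N (cond_N hPi (by omega))
    rw [tgt_N] at a
    have b := ih1 hc (by
      intro D hD
      simp only [List.mem_append, List.mem_cons] at hD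
      rcases hD with hD | rfl | hD
      · exact hΓ D (by simp [hD])
      · omega
      · exact hΓ D (by simp [hD])) hB k (by
      intro E hE
      have hk := (hk E hE).1
      have hs := hk (ldiv A B) (by simp)
      simp only [fsize] at hs
      refine ⟨?_, Or.inl (by omega)⟩
      intro D hD
      simp only [List.mem_append, List.mem_cons] at hD
      rcases hD with hD | rfl | hD
      · exact hk D (by simp [hD])
      · omega
      · exact hk D (by simp [hD]))
    simp only [List.map_append, List.map_cons] at b ⊢
    exact Dv.ldivL _ _ _ _ _ _ _ b a (by simpa using hne)
  | rdivL c Γ Δ Pi A B C h1 h2 hne ih1 ih2 =>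
    have hs := hΓ (rdiv B A) (by simp)
    simp only [fsize] at hs
    have hPi : ∀ D ∈ Pi, fsize D ≤ N := fun D hD => hΓ D (by simp [hD])
    have a := ih2 hc hPi (by omega) N (cond_N hPi (by omega))
    rw [tgt_N] at a
    have b := ih1 hc (by
      intro D hD
      simp only [List.mem_append, List.mem_cons] at hD
      rcases hD with hD | rfl | hD
      · exact hΓ D (by simp [hD])
      · omega
      · exact hΓ D (by simp [hD])) hB k (by
      intro E hE
      have hk := (hk E hE).1
      have hs := hk (rdiv B A) (by simp)
      simp only [fsize] at hs
      refine ⟨?_, Or.inl (by omega)⟩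
      intro D hD
      simp only [List.mem_append, List.mem_cons] at hD
      rcases hD with hD | rfl | hD
      · exact hk D (by simp [hD])
      · omega
      · exact hk D (by simp [hD]))
    simp only [List.map_append, List.map_cons] at b ⊢
    exact Dv.rdivL _ _ _ _ _ _ _ b a (by simpa using hne)
  | mulL c Γ Δ A B C h1 ih1 =>
    have hs := hΓ (mul A B) (by simp)
    simp only [fsize] at hs
    have b := ih1 hc (by
      intro D hD
      simp only [List.mem_append, List.mem_cons] at hD
      rcases hD with hD | rfl | rfl | hD
      · exact hΓ D (by simp [hD])
      · omega
      · omega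
      · exact hΓ D (by simp [hD])) hB k (by
      intro E hE
      have hk := (hk E hE).1
      have hs := hk (mul A B) (by simp)
      simp only [fsize] at hs
      refine ⟨?_, Or.inl (by omega)⟩
      intro D hD
      simp only [List.mem_append, List.mem_cons] at hD
      rcases hD with hD | rfl | rfl | hD
      · exact hk D (by simp [hD])
      · omega
      · omega
      · exact hk D (by simp [hD]))
    simp only [List.map_append, List.map_cons] at b ⊢
    exact Dv.mulL _ _ _ _ _ _ b
  | ldivR c Pi A B h1 hne ih =>
    simp only [fsize] at hB
    have hs : ∀ D ∈ A :: Pi, fsize D ≤ N := by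
      intro D hD
      rcases List.mem_cons.1 hD with rfl | hD
      · omega
      · exact hΓ D hD
    have a := ih hc hs (by omega) N (cond_N hs (by omega))
    rw [tgt_N] at a
    exact Dv.ldivR _ _ _ _ a (by simpa using hne)
  | rdivR c Pi A B h1 hne ih =>
    simp only [fsize] at hB
    have hs : ∀ D ∈ Pi ++ [A], fsize D ≤ N := by
      intro D hD
      simp only [List.mem_append, List.mem_singleton] at hD
      rcases hD with hD | rfl
      · exact hΓ D hD
      · omega
    have a := ih hc hs (by omega) N (cond_N hs (by omega))
    rw [tgt_N, List.map_append] at a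
    exact Dv.rdivR _ _ _ _ a (by simpa using hne)
  | mulR c Pi Psi A B _ _ h1 h2 ih1 ih2 =>
    simp only [fsize] at hB
    have s1 : ∀ D ∈ Pi, fsize D ≤ N := fun D hD => hΓ D (by simp [hD])
    have s2 : ∀ D ∈ Psi, fsize D ≤ N := fun D hD => hΓ D (by simp [hD])
    have a := ih1 hc s1 (by omega) N (cond_N s1 (by omega))
    have b := ih2 hc s2 (by omega) N (cond_N s2 (by omega))
    rw [tgt_N] at a b
    rw [List.map_append]
    exact Dv.mulR _ _ _ _ _ a b (by simpa using h1) (by simpa using h2)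
  | circR c Pi A _ ih =>
    simp only [fsize] at hB
    have a := ih hc hΓ (by omega) N (cond_N hΓ (by omega))
    rw [tgt_N] at a
    exact it_R a k
  | circL c A B _ ih =>
    have hs := (hk A rfl).1
    simp only [List.mem_singleton, forall_eq, fsize] at hs hΓ
    obtain ⟨k, rfl⟩ : ∃ j, k = j + 1 := ⟨k - 1, by omega⟩
    have a := ih hc (by simp; omega) hB k (by
      intro E _
      exact ⟨by simp; omega, Or.inr rfl⟩)
    change Dv P true [fbox l r _] (it l r (k + 1) _)
    rw [it_succ]
    exact Dv.circR _ _ _ (box_mono a)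
  | circC c Pi Psi A _ h1 h2 ih =>
    obtain ⟨hs, hk1⟩ := hk A rfl
    have hk1 : 1 ≤ k := by
      rcases hk1 with h | h
      · exact h
      · have := List.length_pos_of_ne_nil h1
        have := List.length_pos_of_ne_nil h2
        rw [List.length_append] at h
        omega
    have a := ih hc (fun D hD => hΓ D (by simp at hD ⊢; tauto)) hB k (by
      intro E _
      exact ⟨fun D hD => hs D (by simp at hD ⊢; tauto), Or.inl hk1⟩)
    obtain ⟨k, rfl⟩ : ∃ j, k = j + 1 := ⟨k - 1, by omega⟩
    simp only [tgt, it_succ, List.map_append] at a ⊢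
    exact Dv.circC _ _ _ _ a (by simpa using h1) (by simpa using h2)
  | cut => simp at hc

theorem ok_box {b : Bool} {X : Fm P} (h : cyclicOK b X) : cyclicOK b (fbox l r X) := by
  simp [fbox, cyclicOK, h]

theorem ok_it {X : Fm P} (h : cyclicOK true X) (k : ℕ) : cyclicOK true (it l r k X) := by
  induction k with
  | zero => exact h
  | succ k ih => rw [it_succ]; exact ⟨rfl, ok_box ih⟩

theorem ok_tr (N : ℕ) (A : Fm P) : ∀ b, cyclicOK b (trN l r N b A) := by
  induction A with
  | prim p => intro b; cases b <;> trivial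
  | ldiv A B iA iB => intro b; cases b <;> exact ⟨iA _, iB _⟩
  | rdiv B A iB iA => intro b; cases b <;> exact ⟨iB _, iA _⟩
  | mul A B iA iB => intro b; cases b <;> exact ⟨iA _, iB _⟩
  | circ A iA =>
    intro b
    cases b
    · exact ok_box (iA _)
    · exact ok_it (iA _) N

end Fwd

/-- Elimination of `^∘` from antecedents: for distinct fresh primitive types
`l ≠ r` and a bound `N`, for every sequent `A1,…,An → B` whose types have size
at most `N` and contain neither `l` nor `r`: (i) `e_N B` is even-cyclic and
each `o_N Ai` is odd-cyclic; (ii) `A1,…,An → B` is derivable in `L^∘` iff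
`o_N A1,…,o_N An → e_N B` is derivable in `L^∘`. -/
theorem even_odd_translation (P : Type) (l r : P) (hlr : l ≠ r) (N : ℕ)
    (Γ : List (Fm P)) (B : Fm P) (hne : Γ ≠ [])
    (hsz : ∀ A ∈ Γ, fsize A ≤ N) (hszB : fsize B ≤ N)
    (hav : ∀ A ∈ Γ, avoids l r A) (havB : avoids l r B) :
    (cyclicOK true (trN l r N true B) ∧ ∀ A ∈ Γ, cyclicOK false (trN l r N false A)) ∧
    (Dv P true Γ B ↔ Dv P true (Γ.map (trN l r N false)) (trN l r N true B)) := by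
  refine ⟨⟨Fwd.ok_tr N B true, fun A _ => Fwd.ok_tr N A false⟩, fun h => ?_, fun h => ?_⟩
  · have := Fwd.fwd (l := l) (r := r) N (Okada.cut_elim hav havB h) rfl hsz hszB N
      (Fwd.cond_N hsz hszB)
    rwa [Fwd.tgt_N] at this
  · exact (Okada.back hlr N hav havB h).mono
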